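/- There exists an absolute constant c₀ > 0 such that for every integer d ≥ 3, all reals v > 0, ε > 0 and l_b ∈ [0, 1], and every sign θ ∈ {+1, −1} the following holds. Let (α, α') be distributed according to γ_v^d ⊗ γ_v^d (two independent vectors with i.i.d. N(0, v²) coordinates) and set x = l_b·e₁ + e₂ + α and x' = l_b·e₁ + θ·e₃ + α'. Then the probability that |⟨x, x'⟩ − l_b²| > 2εv is at most 2·exp(−ε²/16) + 2·exp(−c₀·(ε/v)·min(1, ε/(dv))). -/

import Mathlib

open MeasureTheory ProbabilityTheory Real

lemma lintegral_ofReal_exp_mul_gaussianReal (w : NNReal) (c : ℝ) :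
    ∫⁻ x, ENNReal.ofReal (exp (c * x)) ∂gaussianReal 0 w
      = ENNReal.ofReal (exp (w * c ^ 2 / 2)) := by
  rw [← ofReal_integral_eq_lintegral_ofReal (integrable_exp_mul_gaussianReal c)
    (.of_forall fun x => (exp_pos _).le)]
  have h := congrFun (mgf_id_gaussianReal (μ := 0) (v := w)) c
  simp only [mgf, id_eq, zero_mul, zero_add] at h
  rw [h]

lemma lintegral_ofReal_exp_mul_sq_gaussianReal_le {w : NNReal} (hw : w ≠ 0) {b : ℝ}
    (hb : 0 ≤ b) (hbw : 4 * b * w ≤ 1) :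
    ∫⁻ x, ENNReal.ofReal (exp (b * x ^ 2)) ∂gaussianReal 0 w
      ≤ ENNReal.ofReal (exp (2 * b * w)) := by
  have hw' : (0 : ℝ) < w := by positivity
  have hu : 0 ≤ 2 * b * w := by positivity
  have hβ : (2 * (w : ℝ))⁻¹ - b = (1 - 2 * b * w) / (2 * w) := by field_simp
  have hβ_pos : 0 < (2 * (w : ℝ))⁻¹ - b := by
    rw [hβ]; exact div_pos (by linarith) (by positivity)
  have hdensity : ∀ x : ℝ, gaussianPDF 0 w x * ENNReal.ofReal (exp (b * x ^ 2))
      = ENNReal.ofReal ((√(2 * π * w))⁻¹ * exp (-((2 * (w : ℝ))⁻¹ - b) * x ^ 2)) := by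
    intro x
    rw [gaussianPDF, ← ENNReal.ofReal_mul (gaussianPDFReal_nonneg _ _ _), gaussianPDFReal,
      mul_assoc, ← exp_add]
    congr 3
    field_simp
    ring
  rw [gaussianReal_of_var_ne_zero _ hw,
    lintegral_withDensity_eq_lintegral_mul _ (measurable_gaussianPDF _ _) (by fun_prop)]
  simp only [Pi.mul_apply, hdensity]
  rw [← ofReal_integral_eq_lintegral_ofReal ((integrable_exp_neg_mul_sq hβ_pos).const_mul _)
    (.of_forall fun x => by positivity), integral_const_mul, integral_gaussian]
  apply ENNReal.ofReal_le_ofReal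
  rw [inv_mul_le_iff₀ (by positivity), ← sqrt_sq (exp_pos (2 * b * w)).le,
    ← sqrt_mul (by positivity)]
  apply sqrt_le_sqrt
  rw [hβ, div_div_eq_mul_div, div_le_iff₀ (by linarith), ← exp_nat_mul]
  have hexp := add_one_le_exp ((2 : ℕ) * (2 * b * w))
  have hkey : 1 ≤ exp ((2 : ℕ) * (2 * b * w)) * (1 - 2 * b * w) := by
    push_cast at hexp ⊢
    nlinarith
  nlinarith [mul_le_mul_of_nonneg_left hkey (by positivity : 0 ≤ 2 * π * w)]

lemma lintegral_ofReal_exp_sum_pi_prod {ι : Type*} [Fintype ι] {μ ν : Measure ℝ}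
    [IsProbabilityMeasure μ] [IsProbabilityMeasure ν] {f : ι → ℝ × ℝ → ℝ}
    (hf : ∀ i, Measurable (f i)) :
    ∫⁻ p, ENNReal.ofReal (exp (∑ i, f i (p.1 i, p.2 i)))
        ∂((Measure.pi fun _ : ι => μ).prod (Measure.pi fun _ : ι => ν))
      = ∏ i, ∫⁻ x, ∫⁻ y, ENNReal.ofReal (exp (f i (x, y))) ∂ν ∂μ := by
  have hg : ∀ i, Measurable fun z => ENNReal.ofReal (exp (f i z)) := fun i => by
    have := hf i
    fun_prop
  rw [← (measurePreserving_arrowProdEquivProdArrow ℝ ℝ ι (fun _ => μ) fun _ => ν).lintegral_comp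
    (by have := fun i => hf i; fun_prop)]
  simp only [MeasurableEquiv.arrowProdEquivProdArrow, MeasurableEquiv.coe_mk,
    Equiv.arrowProdEquivProdArrow, Equiv.coe_fn_mk, Prod.mk.eta, exp_sum,
    ENNReal.ofReal_prod_of_nonneg fun _ _ => (exp_pos _).le]
  rw [lintegral_prod_eq_prod_lintegral_of_indepFun Finset.univ
    (fun i (q : ι → ℝ × ℝ) => ENNReal.ofReal (exp (f i (q i))))
    (iIndepFun_pi fun i => (hg i).aemeasurable) fun i => (hg i).comp (measurable_pi_apply i)]
  refine Finset.prod_congr rfl fun i _ => ?_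
  rw [(measurePreserving_eval (fun _ : ι => μ.prod ν) i).lintegral_comp (hg i),
    lintegral_prod _ (hg i).aemeasurable]

lemma measure_lt_le_of_lintegral_exp_le {Ω : Type*} [MeasurableSpace Ω] {μ : Measure Ω}
    {S : Ω → ℝ} (hS : Measurable S) {a t K : ℝ} (ht : 0 ≤ t)
    (h : ∫⁻ ω, ENNReal.ofReal (exp (t * S ω)) ∂μ ≤ ENNReal.ofReal (exp K)) :
    μ {ω | a < S ω} ≤ ENNReal.ofReal (exp (K - t * a)) := by
  have hsub : {ω | a < S ω}
      ⊆ {ω | ENNReal.ofReal (exp (t * a)) ≤ ENNReal.ofReal (exp (t * S ω))} := fun ω hω =>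
    ENNReal.ofReal_le_ofReal (exp_le_exp.2 (mul_le_mul_of_nonneg_left (le_of_lt hω) ht))
  refine (measure_mono hsub).trans ((meas_ge_le_lintegral_div (by fun_prop)
    (by simp [exp_pos]) ENNReal.ofReal_ne_top).trans ?_)
  rw [exp_sub, ENNReal.ofReal_div_of_pos (exp_pos _)]
  gcongr

lemma measure_lt_abs_le_of_lintegral_exp_le {Ω : Type*} [MeasurableSpace Ω] {μ : Measure Ω}
    {S : Ω → ℝ} (hS : Measurable S) {a t K : ℝ} (ht : 0 ≤ t)
    (h : ∀ s, |s| = t → ∫⁻ ω, ENNReal.ofReal (exp (s * S ω)) ∂μ ≤ ENNReal.ofReal (exp K)) :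
    μ {ω | a < |S ω|} ≤ ENNReal.ofReal (2 * exp (K - t * a)) := by
  have hpos := measure_lt_le_of_lintegral_exp_le (a := a) hS ht (h t (abs_of_nonneg ht))
  have hneg := measure_lt_le_of_lintegral_exp_le (μ := μ) (a := a) (S := fun ω => -S ω) (K := K)
    hS.neg ht (by simpa using h (-t) (by rw [abs_neg, abs_of_nonneg ht]))
  have hset : {ω | a < |S ω|} = {ω | a < S ω} ∪ {ω | a < -S ω} := by
    ext ω
    exact lt_abs (a := a) (b := S ω)
  rw [hset, two_mul, ENNReal.ofReal_add (exp_pos _).le (exp_pos _).le]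
  exact (measure_union_le _ _).trans (add_le_add hpos hneg)

section GaussianPair

variable {ι : Type*} [Fintype ι] {w : NNReal}

lemma lintegral_exp_linear_gaussian (a b : ι → ℝ) (s : ℝ) :
    ∫⁻ p, ENNReal.ofReal (exp (s * ∑ i, (a i * p.1 i + b i * p.2 i)))
        ∂((Measure.pi fun _ : ι => gaussianReal 0 w).prod
          (Measure.pi fun _ : ι => gaussianReal 0 w))
      = ENNReal.ofReal (exp (w * s ^ 2 / 2 * ∑ i, (a i ^ 2 + b i ^ 2))) := by
  simp only [Finset.mul_sum]
  rw [lintegral_ofReal_exp_sum_pi_prod (f := fun i z => s * (a i * z.1 + b i * z.2))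
    (fun i => by fun_prop), exp_sum, ENNReal.ofReal_prod_of_nonneg fun _ _ => (exp_pos _).le]
  refine Finset.prod_congr rfl fun i _ => ?_
  simp only [mul_add, exp_add, ← mul_assoc, ENNReal.ofReal_mul (exp_pos _).le]
  simp only [lintegral_const_mul' _ _ ENNReal.ofReal_ne_top,
    lintegral_mul_const' _ _ ENNReal.ofReal_ne_top, lintegral_ofReal_exp_mul_gaussianReal]
  congr 3 <;> ring

lemma lintegral_exp_inner_gaussian_le (hw : w ≠ 0) {s : ℝ} (hs : 2 * (s * w) ^ 2 ≤ 1) :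
    ∫⁻ p, ENNReal.ofReal (exp (s * ∑ i, p.1 i * p.2 i))
        ∂((Measure.pi fun _ : ι => gaussianReal 0 w).prod
          (Measure.pi fun _ : ι => gaussianReal 0 w))
      ≤ ENNReal.ofReal (exp (Fintype.card ι * (s * w) ^ 2)) := by
  simp only [Finset.mul_sum]
  rw [lintegral_ofReal_exp_sum_pi_prod (f := fun _ z => s * (z.1 * z.2)) (fun i => by fun_prop),
    ← nsmul_eq_mul, ← Finset.card_univ, ← Finset.sum_const, exp_sum,
    ENNReal.ofReal_prod_of_nonneg fun _ _ => (exp_pos _).le]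
  refine Finset.prod_le_prod' fun i _ => ?_
  simp only [← mul_assoc, lintegral_ofReal_exp_mul_gaussianReal]
  have h := lintegral_ofReal_exp_mul_sq_gaussianReal_le hw (b := w * s ^ 2 / 2)
    (by positivity) (by linarith)
  have hexponent : ∀ x : ℝ, w * (s * x) ^ 2 / 2 = w * s ^ 2 / 2 * x ^ 2 := fun x => by ring
  have hbound : (s * w) ^ 2 = 2 * (w * s ^ 2 / 2) * w := by ring
  simpa only [hexponent, hbound] using h

lemma measure_linear_gaussian_lt_abs_le (hw : w ≠ 0) (a b : ι → ℝ)
    (hab : ∑ i, (a i ^ 2 + b i ^ 2) ≤ 4) {r : ℝ} (hr : 0 ≤ r) :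
    ((Measure.pi fun _ : ι => gaussianReal 0 w).prod (Measure.pi fun _ : ι => gaussianReal 0 w))
        {p | r < |∑ i, (a i * p.1 i + b i * p.2 i)|}
      ≤ ENNReal.ofReal (2 * exp (-(r ^ 2 / (8 * w)))) := by
  have hw' : (0 : ℝ) < w := by positivity
  have key := measure_lt_abs_le_of_lintegral_exp_le
    (μ := (Measure.pi fun _ : ι => gaussianReal 0 w).prod
      (Measure.pi fun _ : ι => gaussianReal 0 w))
    (S := fun p => ∑ i, (a i * p.1 i + b i * p.2 i)) (by fun_prop) (a := r)
    (t := r / (4 * w)) (K := w * (r / (4 * w)) ^ 2 / 2 * 4) (by positivity) (fun s hs => by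
      rw [lintegral_exp_linear_gaussian, ← sq_abs s, hs]
      gcongr)
  refine key.trans (le_of_eq ?_)
  congr 3
  field_simp
  ring

lemma measure_inner_gaussian_lt_abs_le [Nonempty ι] (hw : w ≠ 0) {r : ℝ} (hr : 0 ≤ r) :
    ((Measure.pi fun _ : ι => gaussianReal 0 w).prod (Measure.pi fun _ : ι => gaussianReal 0 w))
        {p | r < |∑ i, p.1 i * p.2 i|}
      ≤ ENNReal.ofReal (2 * exp (-(1 / 4 * (r / w) * min 1 (r / (Fintype.card ι * w))))) := by
  have hw' : (0 : ℝ) < w := by positivity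
  have hn : (0 : ℝ) < Fintype.card ι := by exact_mod_cast Fintype.card_pos
  set n : ℝ := (Fintype.card ι : ℝ)
  set m := min 1 (r / (n * w))
  have hm0 : 0 ≤ m := le_min zero_le_one (by positivity)
  have hm1 : m ≤ 1 := min_le_left _ _
  have hm2 : n * m ≤ r / w := by
    have h : m ≤ r / (n * w) := min_le_right _ _
    calc n * m ≤ n * (r / (n * w)) := by gcongr
      _ = r / w := by field_simp
  have key := measure_lt_abs_le_of_lintegral_exp_le
    (μ := (Measure.pi fun _ : ι => gaussianReal 0 w).prod
      (Measure.pi fun _ : ι => gaussianReal 0 w))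
    (S := fun p => ∑ i, p.1 i * p.2 i) (by fun_prop) (a := r)
    (t := m / (2 * w)) (K := n * (m / 2) ^ 2) (by positivity) (fun s hs => by
      have hsw : (s * w) ^ 2 = (m / 2) ^ 2 := by
        rw [mul_pow, ← sq_abs s, hs]
        field_simp
      refine (lintegral_exp_inner_gaussian_le hw (by rw [hsw]; nlinarith)).trans (le_of_eq ?_)
      rw [hsw])
  refine key.trans (ENNReal.ofReal_le_ofReal ?_)
  gcongr
  have h1 : m / (2 * w) * r = m * (r / w) / 2 := by field_simp
  rw [h1]
  nlinarith [mul_le_mul_of_nonneg_left hm2 hm0]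

lemma measure_inner_add_gaussian_lt_abs_le [Nonempty ι] (hw : w ≠ 0) (a b : ι → ℝ)
    (hab : ∑ i, (b i ^ 2 + a i ^ 2) ≤ 4) {r : ℝ} (hr : 0 ≤ r) :
    ((Measure.pi fun _ : ι => gaussianReal 0 w).prod (Measure.pi fun _ : ι => gaussianReal 0 w))
        {p | 2 * r < |∑ i, (a + p.1) i * (b + p.2) i - ∑ i, a i * b i|}
      ≤ ENNReal.ofReal (2 * exp (-(r ^ 2 / (8 * w)))
          + 2 * exp (-(1 / 4 * (r / w) * min 1 (r / (Fintype.card ι * w))))) := by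
  rw [ENNReal.ofReal_add (by positivity) (by positivity)]
  have hlin := measure_linear_gaussian_lt_abs_le hw b a hab hr
  have hinner := measure_inner_gaussian_lt_abs_le (ι := ι) hw hr
  refine le_trans ?_ (add_le_add hlin hinner)
  refine le_trans (measure_mono ?_) (measure_union_le _ _)
  intro p hp
  have hexpand : ∑ i, (a + p.1) i * (b + p.2) i - ∑ i, a i * b i
      = ∑ i, (b i * p.1 i + a i * p.2 i) + ∑ i, p.1 i * p.2 i := by
    rw [← Finset.sum_sub_distrib, ← Finset.sum_add_distrib]
    refine Finset.sum_congr rfl fun i _ => ?_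
    simp only [Pi.add_apply]
    ring
  rw [Set.mem_ofPred_eq, hexpand] at hp
  by_contra hnot
  simp only [Set.mem_union, Set.mem_ofPred_eq, not_or, not_lt] at hnot
  linarith [abs_add_le (∑ i, (b i * p.1 i + a i * p.2 i)) (∑ i, p.1 i * p.2 i)]

end GaussianPair

/-- Concentration of the inner product of two independent samples
`x = l_b·e₁ + e₂ + α`, `x' = l_b·e₁ + θ·e₃ + α'` from clusters of two different concept
pairs (`θ ∈ {+1, −1}`), with Gaussian noises `α, α' ~ N(0, v²I_d)`: with the stated
probability bound, `|⟨x, x'⟩ − l_b²| ≤ 2εv`. -/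
theorem cross_concept_inner_concentration :
    ∃ c₀ : ℝ, 0 < c₀ ∧
      ∀ (d : ℕ) (hd : 3 ≤ d) (v ε lb θ : ℝ), 0 < v → 0 < ε → 0 ≤ lb → lb ≤ 1 →
        (θ = 1 ∨ θ = -1) →
        ((Measure.pi fun _ : Fin d => gaussianReal 0 (v.toNNReal ^ 2)).prod
            (Measure.pi fun _ : Fin d => gaussianReal 0 (v.toNNReal ^ 2)))
          {p : (Fin d → ℝ) × (Fin d → ℝ) |
            2 * ε * v <
              |(∑ m, ((lb • (Pi.single (⟨0, by omega⟩ : Fin d) (1 : ℝ) : Fin d → ℝ)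
                    + (Pi.single (⟨1, by omega⟩ : Fin d) (1 : ℝ) : Fin d → ℝ) + p.1) m)
                  * ((lb • (Pi.single (⟨0, by omega⟩ : Fin d) (1 : ℝ) : Fin d → ℝ)
                    + θ • (Pi.single (⟨2, by omega⟩ : Fin d) (1 : ℝ) : Fin d → ℝ) + p.2) m))
                - lb ^ 2|}
          ≤ ENNReal.ofReal
              (2 * exp (-ε ^ 2 / 16) + 2 * exp (-c₀ * (ε / v) * min 1 (ε / (d * v)))) := by
  refine ⟨1 / 4, by norm_num, fun d hd v ε lb θ hv hε hlb0 hlb1 hθ => ?_⟩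
  have hθ2 : θ ^ 2 = 1 := by rcases hθ with rfl | rfl <;> norm_num
  generalize hi₀ : (⟨0, by omega⟩ : Fin d) = i₀
  generalize hi₁ : (⟨1, by omega⟩ : Fin d) = i₁
  generalize hi₂ : (⟨2, by omega⟩ : Fin d) = i₂
  have h01 : i₀ ≠ i₁ := by simp [← hi₀, ← hi₁]
  have h02 : i₀ ≠ i₂ := by simp [← hi₀, ← hi₂]
  have h12 : i₁ ≠ i₂ := by simp [← hi₁, ← hi₂]
  generalize hA : (lb • Pi.single i₀ 1 + Pi.single i₁ 1 : Fin d → ℝ) = A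
  generalize hB : (lb • Pi.single i₀ 1 + θ • Pi.single i₂ 1 : Fin d → ℝ) = B
  have hAB : ∑ m, A m * B m = lb ^ 2 := by
    simp [← hA, ← hB, add_mul, Finset.sum_add_distrib, Pi.single_apply, h02, h12, sq, h01.symm]
  have hsq : ∑ m, (B m ^ 2 + A m ^ 2) ≤ 4 := by
    have hA2 : ∑ m, A m ^ 2 = lb ^ 2 + 1 := by
      simp [← hA, sq, add_mul, Finset.sum_add_distrib, Pi.single_apply, h01, h01.symm]
    have hB2 : ∑ m, B m ^ 2 = lb ^ 2 + θ ^ 2 := by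
      simp [← hB, sq, add_mul, Finset.sum_add_distrib, Pi.single_apply, h02, h02.symm]
    rw [Finset.sum_add_distrib, hA2, hB2]
    nlinarith
  have hw : v.toNNReal ^ 2 ≠ 0 := by simpa using hv
  have hwv : ((v.toNNReal ^ 2 : NNReal) : ℝ) = v ^ 2 := by simp [hv.le]
  have : Nonempty (Fin d) := ⟨i₀⟩
  have key := measure_inner_add_gaussian_lt_abs_le hw A B hsq (r := ε * v) (by positivity)
  rw [hwv, hAB, Fintype.card_fin, ← mul_assoc] at key
  refine key.trans (ENNReal.ofReal_le_ofReal ?_)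
  have hlin : (ε * v) ^ 2 / (8 * v ^ 2) = ε ^ 2 / 8 := by field_simp
  have hquad₁ : ε * v / v ^ 2 = ε / v := by field_simp
  have hquad₂ : ε * v / (d * v ^ 2) = ε / (d * v) := by field_simp
  rw [hlin, hquad₁, hquad₂, neg_mul, neg_mul]
  gcongr
  linarith [sq_nonneg ε]
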